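/- arXiv:1109.0527 — 2 statements merged into one kernel-verified Lean document; each statement's English description precedes it below -/
import Mathlib

section
/- Let F₀ be a t-generator of ℱ with respect to 𝒯. Suppose F₀ is an ℱ-extension of B by A, where A, B ∈ ℱ and Hom_𝒯(A, B[i]) = 0 for all i ≤ 0. Then A ≅ 0 or B ≅ 0 in 𝒯. -/
open CategoryTheory CategoryTheory.Limits CategoryTheory.Pretriangulated

universe v u

/-- An additive (not necessarily full) subcategory `ℱ` of a category `T` with shifts,
closed under the shift functors `X ↦ X⟦i⟧` for all `i : ℤ`.  It is given by a predicate
on objects and a predicate on morphisms. -/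
structure ShiftedAddSubcat (T : Type u) [Category.{v} T] [Preadditive T]
    [HasShift T ℤ] where
  objs : T → Prop
  homs : ∀ ⦃X Y : T⦄, (X ⟶ Y) → Prop
  homs_id : ∀ (X : T), objs X → homs (𝟙 X)
  homs_comp : ∀ ⦃X Y Z : T⦄ (f : X ⟶ Y) (g : Y ⟶ Z), homs f → homs g → homs (f ≫ g)
  homs_zero : ∀ (X Y : T), objs X → objs Y → homs (0 : X ⟶ Y)
  homs_add : ∀ ⦃X Y : T⦄ (f g : X ⟶ Y), homs f → homs g → homs (f + g)
  homs_neg : ∀ ⦃X Y : T⦄ (f : X ⟶ Y), homs f → homs (-f)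
  objs_shift : ∀ (X : T) (i : ℤ), objs X → objs (X⟦i⟧)
  homs_shift : ∀ ⦃X Y : T⦄ (f : X ⟶ Y) (i : ℤ), homs f → homs (f⟦i⟧')

variable {T : Type u} [Category.{v} T] [Preadditive T] [HasZeroObject T]
  [HasShift T ℤ] [∀ n : ℤ, (shiftFunctor T n).Additive] [Pretriangulated T]

/-- `F` is an `ℱ`-extension of `F₂` by `F₁`: there is a triangle `F₁ → F → F₂ → F₁⟦1⟧`
whose objects and morphisms lie in `ℱ` and which is distinguished in `T`. -/
def ShiftedAddSubcat.IsExt (S : ShiftedAddSubcat T) (F F₁ F₂ : T) : Prop :=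
  S.objs F ∧ S.objs F₁ ∧ S.objs F₂ ∧
    ∃ (f : F₁ ⟶ F) (g : F ⟶ F₂) (h : F₂ ⟶ F₁⟦(1 : ℤ)⟧),
      S.homs f ∧ S.homs g ∧ S.homs h ∧ (Triangle.mk f g h ∈ distTriang T)

/-- `F` has an `ℱ`-filtration with successive quotients `Q 1, …, Q n`. -/
def ShiftedAddSubcat.HasFiltration (S : ShiftedAddSubcat T) (F : T) (n : ℕ)
    (Q : ℕ → T) : Prop :=
  ∃ Fl : ℕ → ℕ → T,
    (∀ i j : ℕ, i < j → j ≤ n → S.objs (Fl i j)) ∧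
    (∀ i : ℕ, 1 ≤ i → i ≤ n → Fl (i - 1) i = Q i) ∧
    Fl 0 n = F ∧
    (∀ i j l : ℕ, i < j → j < l → l ≤ n → S.IsExt (Fl i l) (Fl i j) (Fl j l))

/-- `F₀` is a t-generator of `ℱ` with respect to `T`:  `Hom_T(F₀, F₀⟦i⟧) = 0` for `i < 0`,
and every nonzero object of `ℱ` admits an `ℱ`-filtration with successive quotients
`F₀^{⊕ m i}⟦k i⟧` where `k 1 > k 2 > … > k n`. -/
def ShiftedAddSubcat.IsTGenerator [HasFiniteBiproducts T] (S : ShiftedAddSubcat T)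
    (F₀ : T) : Prop :=
  S.objs F₀ ∧
  (∀ i : ℤ, i < 0 → ∀ f : F₀ ⟶ F₀⟦i⟧, f = 0) ∧
  (∀ F : T, S.objs F → ¬ IsZero F →
    ∃ n : ℕ, 0 < n ∧ ∃ (m : ℕ → ℕ) (k : ℕ → ℤ),
      (∀ i : ℕ, 1 ≤ i → i ≤ n → 1 ≤ m i) ∧
      (∀ i j : ℕ, 1 ≤ i → i < j → j ≤ n → k j < k i) ∧
      S.HasFiltration F n (fun i => (⨁ fun _ : Fin (m i) => F₀)⟦k i⟧))


set_option linter.unusedSectionVars false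

/-- All morphisms `X ⟶ Y` vanish. -/
def HomVanish (X Y : T) : Prop := ∀ f : X ⟶ Y, f = 0

lemma HomVanish.of_iso {X Y X' Y' : T} (h : HomVanish X Y) (e₁ : X ≅ X') (e₂ : Y ≅ Y') :
    HomVanish X' Y' := by
  intro f
  have := h (e₁.hom ≫ f ≫ e₂.inv)
  simpa using this

lemma HomVanish.shift {X Y : T} (h : HomVanish X Y) (a : ℤ) :
    HomVanish (X⟦a⟧) (Y⟦a⟧) := by
  intro f
  obtain ⟨g, rfl⟩ := (shiftFunctor T a).map_surjective f
  rw [h g, Functor.map_zero]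

/-- Vanishing of `Hom(X⟦a⟧, Y⟦b⟧)` depends only on `b - a`. -/
lemma HomVanish.of_sub_eq {X Y : T} {a b : ℤ} (h : HomVanish (X⟦a⟧) (Y⟦b⟧)) (c d : ℤ)
    (hd : b - a = d - c) : HomVanish (X⟦c⟧) (Y⟦d⟧) :=
  (h.shift (c - a)).of_iso
    ((shiftFunctorAdd' T a (c - a) c (by omega)).app X).symm
    ((shiftFunctorAdd' T b (c - a) d (by omega)).app Y).symm

lemma HomVanish.of_shift_left {X Y : T} {a : ℤ} (h : HomVanish (X⟦a⟧) Y) (c d : ℤ)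
    (hd : c - a = d) : HomVanish (X⟦c⟧) (Y⟦d⟧) :=
  (h.of_iso (Iso.refl _) ((shiftFunctorZero T ℤ).app Y).symm).of_sub_eq c d (by omega)

lemma HomVanish.of_shift_right {X Y : T} {b : ℤ} (h : HomVanish X (Y⟦b⟧)) (c d : ℤ)
    (hd : d - c = b) : HomVanish (X⟦c⟧) (Y⟦d⟧) :=
  (h.of_iso ((shiftFunctorZero T ℤ).app X).symm (Iso.refl _)).of_sub_eq c d (by omega)

lemma HomVanish.biproduct_shift_left [HasFiniteBiproducts T] {X Y : T} {m : ℕ} {a : ℤ}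
    (h : HomVanish (X⟦a⟧) Y) : HomVanish ((⨁ fun _ : Fin m => X)⟦a⟧) Y := by
  intro f
  rw [← Category.id_comp f, ← (shiftFunctor T a).map_id, ← biproduct.total, Functor.map_sum,
    Preadditive.sum_comp]
  refine Finset.sum_eq_zero fun i _ => ?_
  rw [Functor.map_comp, Category.assoc, h (_ ≫ f), comp_zero]

lemma HomVanish.biproduct_shift_right [HasFiniteBiproducts T] {X Y : T} {m : ℕ} {a : ℤ}
    (h : HomVanish Y (X⟦a⟧)) : HomVanish Y ((⨁ fun _ : Fin m => X)⟦a⟧) := by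
  intro f
  rw [← Category.comp_id f, ← (shiftFunctor T a).map_id, ← biproduct.total, Functor.map_sum,
    Preadditive.comp_sum]
  refine Finset.sum_eq_zero fun i _ => ?_
  rw [Functor.map_comp, ← Category.assoc, h (f ≫ _), zero_comp]

lemma HomVanish.ext_left {X₁ X₂ X₃ Y : T} {f : X₁ ⟶ X₂} {g : X₂ ⟶ X₃}
    {h : X₃ ⟶ X₁⟦(1 : ℤ)⟧} (hT : Triangle.mk f g h ∈ distTriang T)
    (h₁ : HomVanish X₁ Y) (h₃ : HomVanish X₃ Y) : HomVanish X₂ Y := by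
  intro u
  obtain ⟨v, hv⟩ : ∃ v : X₃ ⟶ Y, u = g ≫ v := Triangle.yoneda_exact₂ _ hT u (h₁ _)
  rw [hv, h₃ v, comp_zero]

lemma HomVanish.ext_right {X₁ X₂ X₃ Y : T} {f : X₁ ⟶ X₂} {g : X₂ ⟶ X₃}
    {h : X₃ ⟶ X₁⟦(1 : ℤ)⟧} (hT : Triangle.mk f g h ∈ distTriang T)
    (h₁ : HomVanish Y X₁) (h₃ : HomVanish Y X₃) : HomVanish Y X₂ := by
  intro u
  obtain ⟨v, hv⟩ : ∃ v : Y ⟶ X₁, u = v ≫ f := Triangle.coyoneda_exact₂ _ hT u (h₃ _)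
  rw [hv, h₁ v, zero_comp]

/-- A property of objects closed under extensions which holds for the successive quotients
of a filtration holds for all of its subquotients. -/
lemma ShiftedAddSubcat.filtration_induction (S : ShiftedAddSubcat T) {n : ℕ}
    {Fl : ℕ → ℕ → T}
    (hFl : ∀ i j l : ℕ, i < j → j < l → l ≤ n → S.IsExt (Fl i l) (Fl i j) (Fl j l))
    (P : T → Prop)
    (hP : ∀ (X₁ X₂ X₃ : T) (f : X₁ ⟶ X₂) (g : X₂ ⟶ X₃) (h : X₃ ⟶ X₁⟦(1 : ℤ)⟧),
      Triangle.mk f g h ∈ distTriang T → P X₁ → P X₃ → P X₂)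
    (i d : ℕ) (hd : i + d + 1 ≤ n) (hQ : ∀ r, i ≤ r → r < i + d + 1 → P (Fl r (r + 1))) :
    P (Fl i (i + d + 1)) := by
  induction d with
  | zero => exact hQ i le_rfl (by omega)
  | succ d ih =>
    obtain ⟨-, -, -, f, g, h, -, -, -, hT⟩ :=
      hFl i (i + d + 1) (i + (d + 1) + 1) (by omega) (by omega) hd
    exact hP _ _ _ f g h hT (ih (by omega) fun r h₁ h₂ => hQ r h₁ (by omega))
      (hQ (i + d + 1) (by omega) (by omega))

/-- A nonzero object of `ℱ` projects onto its lowest piece `F₀^{⊕ m}⟦k⟧`, and the fibre of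
this projection is built from higher shifts of `F₀`. -/
lemma ShiftedAddSubcat.IsTGenerator.exists_last_quotient [HasFiniteBiproducts T]
    {S : ShiftedAddSubcat T} {F₀ : T} (hF₀ : S.IsTGenerator F₀) {A : T} (hA : S.objs A)
    (hA₀ : ¬ IsZero A) :
    ∃ (m : ℕ) (k : ℤ) (A' : T) (i : A' ⟶ A) (p : A ⟶ (⨁ fun _ : Fin m => F₀)⟦k⟧)
      (δ : (⨁ fun _ : Fin m => F₀)⟦k⟧ ⟶ A'⟦(1 : ℤ)⟧), 1 ≤ m ∧
      Triangle.mk i p δ ∈ distTriang T ∧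
      ∀ Y : T, (∀ j, k < j → HomVanish (F₀⟦j⟧) Y) → HomVanish A' Y := by
  obtain ⟨n, hn, m, k, hm, hk, Fl, -, hQ, rfl, hFl⟩ := hF₀.2.2 A hA hA₀
  obtain ⟨n, rfl⟩ := Nat.exists_eq_add_of_lt hn
  have hQ' : ∀ r, r ≤ n → Fl r (r + 1) = (⨁ fun _ : Fin (m (r + 1)) => F₀)⟦k (r + 1)⟧ :=
    fun r hr => hQ (r + 1) (by omega) (by omega)
  rw [zero_add] at *
  rcases n with _ | n
  · rw [hQ' 0 le_rfl]
    exact ⟨m 1, k 1, _, 0, 𝟙 _, 0, hm 1 le_rfl le_rfl, contractible_distinguished₁ _,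
      fun Y _ f => (isZero_zero T).eq_of_src _ _⟩
  · have hext := hFl 0 (n + 1) (n + 1 + 1) (by omega) (by omega) le_rfl
    rw [hQ' (n + 1) le_rfl] at hext
    obtain ⟨-, -, -, f, g, h, -, -, -, hT⟩ := hext
    refine ⟨_, _, _, f, g, h, hm (n + 1 + 1) (by omega) le_rfl, hT, fun Y hY => ?_⟩
    have := S.filtration_induction hFl (fun X => HomVanish X Y)
      (fun _ _ _ _ _ _ => HomVanish.ext_left) 0 n (by omega) fun r _ hr => by
        rw [hQ' r (by omega)]
        exact (hY _ (hk _ _ (by omega) (by omega) le_rfl)).biproduct_shift_left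
    rwa [zero_add] at this

/-- A nonzero object of `ℱ` receives a map from its highest piece `F₀^{⊕ m}⟦k⟧`, and the
cofibre of this map is built from lower shifts of `F₀`. -/
lemma ShiftedAddSubcat.IsTGenerator.exists_first_piece [HasFiniteBiproducts T]
    {S : ShiftedAddSubcat T} {F₀ : T} (hF₀ : S.IsTGenerator F₀) {B : T} (hB : S.objs B)
    (hB₀ : ¬ IsZero B) :
    ∃ (m : ℕ) (k : ℤ) (B' : T) (i : (⨁ fun _ : Fin m => F₀)⟦k⟧ ⟶ B) (p : B ⟶ B')
      (δ : B' ⟶ (⨁ fun _ : Fin m => F₀)⟦k⟧⟦(1 : ℤ)⟧), 1 ≤ m ∧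
      Triangle.mk i p δ ∈ distTriang T ∧
      ∀ Y : T, (∀ j, j < k → HomVanish Y (F₀⟦j⟧)) → HomVanish Y B' := by
  obtain ⟨n, hn, m, k, hm, hk, Fl, -, hQ, rfl, hFl⟩ := hF₀.2.2 B hB hB₀
  obtain ⟨n, rfl⟩ := Nat.exists_eq_add_of_lt hn
  have hQ' : ∀ r, r ≤ n → Fl r (r + 1) = (⨁ fun _ : Fin (m (r + 1)) => F₀)⟦k (r + 1)⟧ :=
    fun r hr => hQ (r + 1) (by omega) (by omega)
  rw [zero_add] at *
  rcases n with _ | n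
  · rw [hQ' 0 le_rfl]
    exact ⟨m 1, k 1, _, 𝟙 _, 0, 0, hm 1 le_rfl le_rfl, contractible_distinguished _,
      fun Y _ f => (isZero_zero T).eq_of_tgt _ _⟩
  · have hext := hFl 0 1 (n + 1 + 1) (by omega) (by omega) le_rfl
    rw [hQ' 0 (by omega)] at hext
    obtain ⟨-, -, -, f, g, h, -, -, -, hT⟩ := hext
    refine ⟨_, _, _, f, g, h, hm 1 le_rfl (by omega), hT, fun Y hY => ?_⟩
    have := S.filtration_induction hFl (fun X => HomVanish Y X)
      (fun _ _ _ _ _ _ => HomVanish.ext_right) 1 n (by omega) fun r _ hr => by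
        rw [hQ' r (by omega)]
        exact (hY _ (hk _ _ (by omega) (by omega) (by omega))).biproduct_shift_right
    rwa [show 1 + n + 1 = n + 1 + 1 by omega] at this

/-- If `F₀` is a t-generator of `ℱ` with respect to `T`, and `F₀` is an `ℱ`-extension of
`B` by `A` with `Hom_T(A, B⟦i⟧) = 0` for all `i ≤ 0`, then `A ≅ 0` or `B ≅ 0` in `T`. -/
theorem isZero_or_isZero_of_ext [HasFiniteBiproducts T]
    (S : ShiftedAddSubcat T) (F₀ : T) (hF₀ : S.IsTGenerator F₀)
    (A B : T) (hext : S.IsExt F₀ A B)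
    (hvan : ∀ i : ℤ, i ≤ 0 → ∀ f : A ⟶ B⟦i⟧, f = 0) :
    IsZero A ∨ IsZero B := by
  obtain ⟨-, hA, hB, f, g, h, -, -, -, hT⟩ := hext
  by_contra! hAB
  obtain ⟨hA₀, hB₀⟩ := hAB
  have hFF (a b : ℤ) (hab : b < a) : HomVanish (F₀⟦a⟧) (F₀⟦b⟧) :=
    HomVanish.of_shift_right (hF₀.2.1 (b - a) (by omega)) a b rfl
  have e₀ (X : T) : X⟦(0 : ℤ)⟧ ≅ X := (shiftFunctorZero T ℤ).app X
  have hAB₁ : HomVanish (A⟦(1 : ℤ)⟧) B :=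
    (HomVanish.of_shift_right (hvan (-1) (by omega)) 1 0 (by omega)).of_iso (Iso.refl _) (e₀ B)
  have hAF : ¬ HomVanish A F₀ := by
    intro hf
    apply hA₀
    obtain ⟨w, hw⟩ : ∃ w : A⟦(1 : ℤ)⟧ ⟶ B, 𝟙 _ = w ≫ h :=
      Triangle.coyoneda_exact₁ _ hT (𝟙 (A⟦(1 : ℤ)⟧)) (by
        change _ ≫ f⟦(1 : ℤ)⟧' = 0
        rw [hf f, Functor.map_zero, comp_zero])
    rw [hAB₁ w, zero_comp, ← (shiftFunctor T (1 : ℤ)).map_id, Functor.map_eq_zero_iff] at hw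
    exact (IsZero.iff_id_eq_zero A).2 hw
  have hFB : ¬ HomVanish F₀ B := by
    intro hg
    apply hB₀
    obtain ⟨w, hw⟩ : ∃ w : A⟦(1 : ℤ)⟧ ⟶ B, 𝟙 B = h ≫ w :=
      Triangle.yoneda_exact₃ _ hT (𝟙 B) (by
        change g ≫ 𝟙 B = 0
        rw [hg g, zero_comp])
    rw [hAB₁ w, comp_zero] at hw
    exact (IsZero.iff_id_eq_zero B).2 hw
  obtain ⟨m, k, A', i, p, δ, hm, hTA, hA'⟩ := hF₀.exists_last_quotient hA hA₀
  obtain ⟨m', l, B', j, q, ε, hm', hTB, hB'⟩ := hF₀.exists_first_piece hB hB₀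
  have hA_van (Y : T) (hY : ∀ j, k ≤ j → HomVanish (F₀⟦j⟧) Y) : HomVanish A Y :=
    HomVanish.ext_left hTA (hA' Y fun j hj => hY j hj.le) (hY k le_rfl).biproduct_shift_left
  have hB_van (Y : T) (hY : ∀ j, j ≤ l → HomVanish Y (F₀⟦j⟧)) : HomVanish Y B :=
    HomVanish.ext_right hTB (hY l le_rfl).biproduct_shift_right (hB' Y fun j hj => hY j hj.le)
  have hk : k ≤ 0 := by
    by_contra! hk
    exact hAF (hA_van F₀ fun j hj => (hFF j 0 (by omega)).of_iso (Iso.refl _) (e₀ F₀))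
  have hl : 0 ≤ l := by
    by_contra! hl
    exact hFB (hB_van F₀ fun j hj => (hFF 0 j (by omega)).of_iso (e₀ F₀) (Iso.refl _))
  let e : (⨁ fun _ : Fin m' => F₀)⟦k⟧ ≅ (⨁ fun _ : Fin m' => F₀)⟦l⟧⟦k - l⟧ :=
    (shiftFunctorAdd' T l (k - l) k (by omega)).app _
  let s : (⨁ fun _ : Fin m => F₀) ⟶ (⨁ fun _ : Fin m' => F₀) :=
    biproduct.π (fun _ : Fin m => F₀) ⟨0, hm⟩ ≫ biproduct.ι (fun _ : Fin m' => F₀) ⟨0, hm'⟩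
  have hps : p ≫ s⟦k⟧' ≫ e.hom = 0 := by
    have hzero : (p ≫ s⟦k⟧' ≫ e.hom) ≫ j⟦k - l⟧' = 0 := hvan (k - l) (by omega) _
    obtain ⟨w, d, hw⟩ : ∃ (w : A ⟶ B'⟦k - l⟧⟦(-1 : ℤ)⟧)
        (d : B'⟦k - l⟧⟦(-1 : ℤ)⟧ ⟶ _), p ≫ s⟦k⟧' ≫ e.hom = w ≫ d := by
      obtain ⟨w, hw⟩ :=
        Triangle.coyoneda_exact₂ _
          (inv_rot_of_distTriang _ (Triangle.shift_distinguished _ hTB (k - l))) (p ≫ s⟦k⟧' ≫ e.hom)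
          (by
            change (p ≫ s⟦k⟧' ≫ e.hom) ≫ ((k - l).negOnePow • j⟦k - l⟧') = 0
            rw [Linear.comp_units_smul, hzero, smul_zero])
      exact ⟨w, _, hw⟩
    have hB'₁ : HomVanish A (B'⟦k - l⟧⟦(-1 : ℤ)⟧) := by
      refine hA_van _ fun r hr => ?_
      have hF : HomVanish (F₀⟦r - (k - l - 1)⟧) B' := hB' _ fun t ht => hFF _ _ (by omega)
      exact (hF.of_shift_left r (k - l - 1) (by omega)).of_iso (Iso.refl _)
        ((shiftFunctorAdd' T (k - l) (-1) (k - l - 1) (by omega)).app B')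
    rw [hw, hB'₁ w, zero_comp]
  have hs : s⟦k⟧' ≫ e.hom = 0 := by
    obtain ⟨w, hw⟩ : ∃ w : A'⟦(1 : ℤ)⟧ ⟶ (⨁ fun _ : Fin m' => F₀)⟦l⟧⟦k - l⟧,
        s⟦k⟧' ≫ e.hom = δ ≫ w := Triangle.yoneda_exact₃ _ hTA _ hps
    have hA'₁ : HomVanish (A'⟦(1 : ℤ)⟧) ((⨁ fun _ : Fin m' => F₀)⟦l⟧⟦k - l⟧) := by
      have hF : HomVanish A' ((⨁ fun _ : Fin m' => F₀)⟦k - 1⟧) :=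
        hA' _ fun r hr => (hFF r (k - 1) (by omega)).biproduct_shift_right
      exact (hF.of_shift_right 1 k rfl).of_iso (Iso.refl _) e
    rw [hw, hA'₁ w, comp_zero]
  have hs₀ : s = 0 := by
    rwa [Preadditive.IsIso.comp_right_eq_zero, Functor.map_eq_zero_iff] at hs
  refine hAF fun u => ?_
  have hid : 𝟙 F₀ = 0 := by
    have : biproduct.ι (fun _ : Fin m => F₀) ⟨0, hm⟩ ≫ s ≫
      biproduct.π (fun _ : Fin m' => F₀) ⟨0, hm'⟩ = 𝟙 F₀ := by simp [s]
    rw [← this, hs₀, zero_comp, comp_zero]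
  rw [← Category.comp_id u, hid, comp_zero]
end

section
/- Let D be a squarefree integer with D < −1, let K = ℚ(√D) with δ ∈ K satisfying δ² = D, let σ be the nontrivial field automorphism of K over ℚ, and let Nm : Kˣ → ℚˣ be the norm, Nm(a) = a·σ(a). Let U be the unitary group of the skew-Hermitian form given by J = [[0, 1], [−1, 0]], i.e., U = {g ∈ GL₂(K) : σ(g)ᵀ · J · g = J}, where σ(g) is the entrywise application of σ. For a ∈ Kˣ, set g_a = diag(a⁻¹, σ(a)) ∈ U. Then there is no group homomorphism ρ : U → ℚˣ such that for every a ∈ Kˣ one has ρ(g_a) ≡ Nm(a) modulo (ℚˣ)², i.e., ρ(g_a)·Nm(a)⁻¹ is a square in ℚˣ. -/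
open Matrix

/-- The diagonal matrix `g_a = diag(a⁻¹, σ a)`, as a unit of the ring of `2 × 2` matrices
over `K`, for a unit `a : Kˣ` and a field automorphism `σ` of `K`. -/
noncomputable def gDiag {K : Type} [Field K] [Algebra ℚ K] (σ : K ≃ₐ[ℚ] K) (a : Kˣ) :
    (Matrix (Fin 2) (Fin 2) K)ˣ where
  val := Matrix.diagonal ![((a⁻¹ : Kˣ) : K), σ a]
  inv := Matrix.diagonal ![(a : K), σ ((a⁻¹ : Kˣ) : K)]
  val_inv := by
    rw [Matrix.diagonal_mul_diagonal]
    have : (fun i => (![((a⁻¹ : Kˣ) : K), σ a] i) * (![(a : K), σ ((a⁻¹ : Kˣ) : K)] i))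
        = fun _ => (1 : K) := by
      funext i
      fin_cases i
      · simp
      · simp [← _root_.map_mul]
    rw [this, Matrix.diagonal_one]
  inv_val := by
    rw [Matrix.diagonal_mul_diagonal]
    have : (fun i => (![(a : K), σ ((a⁻¹ : Kˣ) : K)] i) * (![((a⁻¹ : Kˣ) : K), σ a] i))
        = fun _ => (1 : K) := by
      funext i
      fin_cases i
      · simp
      · simp [← _root_.map_mul]
    rw [this, Matrix.diagonal_one]

/-- The Weyl element `[[0, 1], [-1, 0]]` as a unit of the ring of `2 × 2` matrices. -/
def weylUnit (K : Type) [Field K] : (Matrix (Fin 2) (Fin 2) K)ˣ where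
  val := !![0, 1; -1, 0]
  inv := !![0, -1; 1, 0]
  val_inv := by simp [Matrix.one_fin_two]
  inv_val := by simp [Matrix.one_fin_two]

theorem weylUnit_pow_four (K : Type) [Field K] :
    weylUnit K * weylUnit K * (weylUnit K * weylUnit K) = 1 := by
  ext1
  simp [weylUnit, Matrix.one_fin_two]

theorem coe_gDiag {K : Type} [Field K] [Algebra ℚ K] (σ : K ≃ₐ[ℚ] K) (a : Kˣ) :
    (gDiag σ a : Matrix (Fin 2) (Fin 2) K) = !![(a : K)⁻¹, 0; 0, σ a] := by
  ext i j
  fin_cases i <;> fin_cases j <;> simp [gDiag]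

theorem weylUnit_mul_gDiag_sq {K : Type} [Field K] [Algebra ℚ K] (σ : K ≃ₐ[ℚ] K) (a : Kˣ)
    (ha : σ a = -a) :
    weylUnit K * gDiag σ a * (weylUnit K * gDiag σ a) = 1 := by
  ext1
  simp [weylUnit, coe_gDiag, ha, Matrix.one_fin_two]

theorem neg_ne_sq_of_squarefree {D : ℤ} (hD : Squarefree D) (hD1 : D < -1) (t : ℚ) :
    -(D : ℚ) ≠ t ^ 2 := by
  intro h
  have hs : IsSquare ((-D : ℤ) : ℚ) := ⟨t, by push_cast; rw [h, sq]⟩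
  obtain ⟨n, hn⟩ := Rat.isSquare_intCast_iff.mp hs
  have hu : IsUnit n := hD n ⟨-1, by linarith⟩
  have := Int.isUnit_mul_self hu
  omega


/-- Let `D < -1` be a squarefree integer, `K = ℚ(√D)` with `δ² = D`, `σ` the nontrivial
automorphism of `K` over `ℚ` (so `Nm a = a * σ a`), and let `U` be the unitary group of
the skew-Hermitian form `J = [[0, 1], [-1, 0]]`, i.e. the group of invertible `2 × 2`
matrices `g` over `K` with `σ(g)ᵀ * J * g = J`.  Then there is no group homomorphism
`ρ : U → ℚˣ` with `ρ(g_a) ≡ Nm(a) mod (ℚˣ)²` for all `a ∈ Kˣ`, where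
`g_a = diag(a⁻¹, σ a) ∈ U`. -/
theorem no_norm_lift
    (D : ℤ) (hD : Squarefree D) (hD1 : D < -1)
    (K : Type) [Field K] [Algebra ℚ K]
    (hrank : Module.finrank ℚ K = 2)
    (δ : K) (hδ : δ ^ 2 = (D : K)) (hgen : Algebra.adjoin ℚ {δ} = ⊤)
    (σ : K ≃ₐ[ℚ] K) (hσδ : σ δ = -δ) (hσ2 : ∀ x : K, σ (σ x) = x)
    (J : Matrix (Fin 2) (Fin 2) K) (hJ : J = !![0, 1; -1, 0]) :
    ¬ ∃ ρ : (Matrix (Fin 2) (Fin 2) K)ˣ → ℚˣ,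
      (∀ g h : (Matrix (Fin 2) (Fin 2) K)ˣ,
        ((g : Matrix (Fin 2) (Fin 2) K).map σ)ᵀ * J * (g : Matrix (Fin 2) (Fin 2) K) = J →
        ((h : Matrix (Fin 2) (Fin 2) K).map σ)ᵀ * J * (h : Matrix (Fin 2) (Fin 2) K) = J →
        ρ (g * h) = ρ g * ρ h) ∧
      (∀ a : Kˣ, ∃ t : ℚˣ,
        (a : K) * σ a = algebraMap ℚ K ((ρ (gDiag σ a) : ℚ) * (t : ℚ) ^ 2)) := by
  subst hJ
  rintro ⟨ρ, hmul, hnorm⟩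
  have : CharZero K := algebraRat.charZero K
  have hδ0 : δ ≠ 0 := by
    rintro rfl
    have hD0 : (D : K) = 0 := by simpa using hδ.symm
    have : D = 0 := by exact_mod_cast hD0
    omega
  set a : Kˣ := Units.mk0 δ hδ0
  have ha : σ a = -a := hσδ
  set w := weylUnit K
  set g := gDiag σ a
  have hw : ((w : Matrix (Fin 2) (Fin 2) K).map σ)ᵀ * !![0, 1; -1, 0] *
      (w : Matrix (Fin 2) (Fin 2) K) = !![0, 1; -1, 0] := by
    ext i j
    fin_cases i <;> fin_cases j <;> simp [w, weylUnit, Matrix.mul_apply, Fin.sum_univ_two]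
  have hg : ((g : Matrix (Fin 2) (Fin 2) K).map σ)ᵀ * !![0, 1; -1, 0] *
      (g : Matrix (Fin 2) (Fin 2) K) = !![0, 1; -1, 0] := by
    ext i j
    fin_cases i <;> fin_cases j <;>
      simp [g, coe_gDiag, Matrix.mul_apply, Fin.sum_univ_two, hσ2]
  have closed : ∀ x y : (Matrix (Fin 2) (Fin 2) K)ˣ,
      ((x : Matrix (Fin 2) (Fin 2) K).map σ)ᵀ * !![0, 1; -1, 0] *
        (x : Matrix (Fin 2) (Fin 2) K) = !![0, 1; -1, 0] →
      ((y : Matrix (Fin 2) (Fin 2) K).map σ)ᵀ * !![0, 1; -1, 0] *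
        (y : Matrix (Fin 2) (Fin 2) K) = !![0, 1; -1, 0] →
      (((x * y : (Matrix (Fin 2) (Fin 2) K)ˣ) : Matrix (Fin 2) (Fin 2) K).map σ)ᵀ *
        !![0, 1; -1, 0] * ((x * y : (Matrix (Fin 2) (Fin 2) K)ˣ) : Matrix (Fin 2) (Fin 2) K)
        = !![0, 1; -1, 0] := by
    intro x y hx hy
    rw [Units.val_mul, Matrix.map_mul, Matrix.transpose_mul]
    nth_rewrite 2 [← hy]
    nth_rewrite 2 [← hx]
    simp only [Matrix.mul_assoc]
  have h1 : ρ 1 = 1 := by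
    have h := hmul 1 1 (by simp) (by simp)
    simpa using h
  have hw4 : ρ w * ρ w * (ρ w * ρ w) = 1 := by
    rw [← hmul w w hw hw, ← hmul _ _ (closed w w hw hw) (closed w w hw hw),
      weylUnit_pow_four, h1]
  have hwg : ρ w * ρ g * (ρ w * ρ g) = 1 := by
    rw [← hmul w g hw hg, ← hmul _ _ (closed w g hw hg) (closed w g hw hg),
      weylUnit_mul_gDiag_sq σ a ha, h1]
  have hg4 : ((ρ g : ℚ)) ^ 4 = 1 := by
    have h : ρ g ^ 4 = 1 := by
      calc ρ g ^ 4 = ρ w * ρ w * (ρ w * ρ w) * ρ g ^ 4 := by rw [hw4, one_mul]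
        _ = (ρ w * ρ g * (ρ w * ρ g)) ^ 2 := by
          simp only [pow_succ, pow_zero, one_mul]
          ac_rfl
        _ = 1 := by rw [hwg, one_pow]
    rw [← Units.val_pow_eq_pow_val, h, Units.val_one]
  obtain ⟨t, ht⟩ := hnorm a
  have ht' : -(D : ℚ) = (ρ g : ℚ) * (t : ℚ) ^ 2 := by
    apply (algebraMap ℚ K).injective
    rw [← ht, ha, map_neg, map_intCast, ← hδ]
    simp only [a, Units.val_mk0]
    ring
  have hneg : (D : ℚ) < 0 := by
    have : D < 0 := by omega
    exact_mod_cast this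
  rcases (pow_eq_one_iff_of_ne_zero (by norm_num)).mp hg4 with h | ⟨h, -⟩
  · exact neg_ne_sq_of_squarefree hD hD1 t (by rw [ht', h, one_mul])
  · rw [h] at ht'
    nlinarith [sq_nonneg (t : ℚ)]
end
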